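/- Let r, s : ℝ × ℝ → ℝ be differentiable at a point x ∈ ℝ × ℝ, let h, h̃ : ℝ → ℝ be differentiable at s(x), and let λ ∈ ℝ with λ ≠ 0. Define φ(y) = h(s y) · exp(λ · r y) and φ̃(y) = h̃(s y) · exp(λ · r y), and write ∂₁f = fderiv ℝ f x (1,0), ∂₂f = fderiv ℝ f x (0,1). Assume the transversality condition (∂₁r)·(∂₂s) − (∂₂r)·(∂₁s) ≠ 0 at x. Then the level sets of φ and φ̃ are tangent at x, i.e. (∂₁φ)·(∂₂φ̃) − (∂₂φ)·(∂₁φ̃) = 0, if and only if the data compatibility condition h(s x)·(deriv h̃)(s x) = (deriv h)(s x)·h̃(s x) holds. -/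

import Mathlib

/-- The derivative of `y ↦ g (s y) * exp (c * r y)` at `x` in the direction `v`. -/
theorem fderiv_comp_mul_exp_apply {E : Type*} [NormedAddCommGroup E] [NormedSpace ℝ E]
    {r s : E → ℝ} {x : E} {g : ℝ → ℝ} (hr : DifferentiableAt ℝ r x)
    (hs : DifferentiableAt ℝ s x) (hg : DifferentiableAt ℝ g (s x)) (c : ℝ) (v : E) :
    fderiv ℝ (fun y => g (s y) * Real.exp (c * r y)) x v =
      Real.exp (c * r x) * (deriv g (s x) * fderiv ℝ s x v + c * g (s x) * fderiv ℝ r x v) := by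
  have hgs : HasFDerivAt (fun y => g (s y)) (deriv g (s x) • fderiv ℝ s x) x :=
    hg.hasDerivAt.comp_hasFDerivAt x hs.hasFDerivAt
  rw [(hgs.fun_mul (hr.hasFDerivAt.const_mul c).exp).fderiv]
  simp only [add_apply, smul_apply, smul_eq_mul]
  ring

/-- Theorem 4: under the transversality condition on `(r, s)`, level sets of
the two eigenfunctions `φ = (h∘s)e^{λr}` and `φt = (ht∘s)e^{λr}` are tangent
at `x` iff the data compatibility condition holds. -/
theorem tangency_iff_data_compatibility
    (r s : ℝ × ℝ → ℝ) (x : ℝ × ℝ)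
    (hr : DifferentiableAt ℝ r x) (hs : DifferentiableAt ℝ s x)
    (h ht : ℝ → ℝ)
    (hh : DifferentiableAt ℝ h (s x)) (hht : DifferentiableAt ℝ ht (s x))
    (lam : ℝ) (hlam : lam ≠ 0)
    (φ φt : ℝ × ℝ → ℝ)
    (hφ : φ = fun y => h (s y) * Real.exp (lam * r y))
    (hφt : φt = fun y => ht (s y) * Real.exp (lam * r y))
    (htrans : fderiv ℝ r x (1, 0) * fderiv ℝ s x (0, 1)
        - fderiv ℝ r x (0, 1) * fderiv ℝ s x (1, 0) ≠ 0) :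
    (fderiv ℝ φ x (1, 0) * fderiv ℝ φt x (0, 1)
        - fderiv ℝ φ x (0, 1) * fderiv ℝ φt x (1, 0) = 0) ↔
      h (s x) * deriv ht (s x) = deriv h (s x) * ht (s x) := by
  subst hφ hφt
  simp only [fderiv_comp_mul_exp_apply hr hs hh, fderiv_comp_mul_exp_apply hr hs hht]
  have factorization (E a b a' b' r₁ r₂ s₁ s₂ : ℝ) :
      E * (a' * s₁ + lam * a * r₁) * (E * (b' * s₂ + lam * b * r₂)) -
        E * (a' * s₂ + lam * a * r₂) * (E * (b' * s₁ + lam * b * r₁)) =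
      E ^ 2 * lam * (r₁ * s₂ - r₂ * s₁) * (a * b' - a' * b) := by
    ring
  rw [factorization, mul_eq_zero_iff_left
    (mul_ne_zero (mul_ne_zero (pow_ne_zero 2 (Real.exp_ne_zero _)) hlam) htrans), sub_eq_zero]
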